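/- Let G be a finite simple semi-balanced digraph with a ribbon structure, a basis (b_0, b_0b_1), and a distinguished directed edge u→v of G. Then the edge set H produced by the u→v-almost greedy process is acyclic, i.e. the process produces a (not necessarily spanning) tree. -/

import Mathlib

open scoped Classical Pointwise

namespace SEP

variable {V : Type*} [Fintype V] [DecidableEq V]

/-- The undirected simple graph underlying a set of directed edges. -/
def fromDir (D : Set (V × V)) : SimpleGraph V :=
  SimpleGraph.fromRel (fun u v => (u, v) ∈ D)

/-- A layering of a simple graph `G`: the layer difference along each edge is at most one,
and the edges with layer difference exactly one form a connected spanning subgraph. -/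
structure IsLayering (G : SimpleGraph V) (l : V → ℤ) : Prop where
  step : ∀ ⦃u v⦄, G.Adj u v → |l u - l v| ≤ 1
  conn : (SimpleGraph.fromRel fun u v => G.Adj u v ∧ |l u - l v| = 1).Connected

/-- The facet graph (as a set of directed edges) associated to a layering. -/
def facetDigraph (G : SimpleGraph V) (l : V → ℤ) : Set (V × V) :=
  {p | G.Adj p.1 p.2 ∧ l p.2 - l p.1 = 1}

/-- `D` is a facet graph of `G`. -/
def IsFacetGraph (G : SimpleGraph V) (D : Set (V × V)) : Prop :=
  ∃ l : V → ℤ, IsLayering G l ∧ D = facetDigraph G l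

/-- A ribbon structure on `G`: at each vertex a cyclic permutation of the incident edges,
encoded by the "next neighbour" function `ρ`. -/
structure IsRibbon (G : SimpleGraph V) (ρ : V → V → V) : Prop where
  adj : ∀ ⦃x y⦄, G.Adj x y → G.Adj x (ρ x y)
  cyc : ∀ ⦃x y z⦄, G.Adj x y → G.Adj x z → ∃ k : ℕ, (ρ x)^[k] y = z

/-- One step of the Bernardi tour of the tree with (undirected) edge set `T`:
from the node–edge pair (x, xy) move to (y, yx⁺) if xy is a tree edge
and to (x, xy⁺) otherwise. -/
noncomputable def tourStep (ρ : V → V → V) (T : Set (Sym2 V)) (p : V × V) : V × V :=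
  if s(p.1, p.2) ∈ T then (p.2, ρ p.2 p.1) else (p.1, ρ p.1 p.2)

/-- The tour of the tree `T`, starting at the basis `(b0, b0b1)`. -/
noncomputable def tourSeq (ρ : V → V → V) (T : Set (Sym2 V)) (b0 b1 : V) (n : ℕ) : V × V :=
  (tourStep ρ T)^[n] (b0, b1)

/-- The first time the node–edge pair (x, edge xy) becomes current in the tour of `T`. -/
noncomputable def firstVisit (ρ : V → V → V) (T : Set (Sym2 V)) (b0 b1 x y : V) : ℕ :=
  sInf {n | tourSeq ρ T b0 b1 n = (x, y)}

/-- The undirected edge set of a set of directed edges. -/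
def und (T : Set (V × V)) : Set (Sym2 V) := {e | ∃ p ∈ T, e = s(p.1, p.2)}

/-- `T` is a spanning tree of the digraph `D`, recorded with its orientation. -/
def IsSpanningTreeOf (T D : Set (V × V)) : Prop :=
  T ⊆ D ∧ (fromDir T).IsTree

/-- `T` is a Jaeger tree of the digraph `D` with respect to the ribbon structure `ρ` and the
basis `(b0, b1)`: it is a spanning tree of `D` and every directed edge t→h of `D` not in `T`
is first reached at its tail `t` in the tour of `T`. -/
def IsJaegerTree (ρ : V → V → V) (b0 b1 : V) (D T : Set (V × V)) : Prop :=
  IsSpanningTreeOf T D ∧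
    ∀ p ∈ D, s(p.1, p.2) ∉ und T →
      firstVisit ρ (und T) b0 b1 p.1 p.2 < firstVisit ρ (und T) b0 b1 p.2 p.1

/-- The directed edge `p = (t, h)` of `T` is a tail-edge of `T` w.r.t. the base vertex `b0`:
`b0` and `t` lie in the same component of `T - th`. -/
def IsTailEdge (b0 : V) (T : Set (V × V)) (p : V × V) : Prop :=
  p ∈ T ∧ (fromDir (T \ {p})).Reachable b0 p.1

/-- The set of tail-edges of `T`. -/
def tailEdges (b0 : V) (T : Set (V × V)) : Set (V × V) :=
  {p | IsTailEdge b0 T p}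

/-- The number of tail-edges of `T`. -/
noncomputable def numTailEdges (b0 : V) (T : Set (V × V)) : ℕ :=
  Nat.card (tailEdges b0 T)

/-- The ordering `≺` of Jaeger trees of one facet graph: `T' ≺ T` iff their tours first
differ at a current node–edge pair `(t, th)` with the directed edge `th ∉ T'` and `th ∈ T`. -/
def treePrec (ρ : V → V → V) (b0 b1 : V) (T' T : Set (V × V)) : Prop :=
  ∃ n : ℕ, (∀ m ≤ n, tourSeq ρ (und T') b0 b1 m = tourSeq ρ (und T) b0 b1 m) ∧
    tourSeq ρ (und T) b0 b1 n ∈ T ∧ tourSeq ρ (und T) b0 b1 n ∉ T'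

/-- The standard basis vector of `ℝ^V` corresponding to a vertex. -/
noncomputable def stdVec (v : V) : V → ℝ := fun w => if w = v then 1 else 0

/-- The symmetric edge polytope of `G`. -/
noncomputable def symEdgePolytope (G : SimpleGraph V) : Set (V → ℝ) :=
  convexHull ℝ {x | ∃ u v, G.Adj u v ∧ x = stdVec u - stdVec v}

/-- The (root polytope) simplex spanned by a set of directed edges. -/
noncomputable def simplexOf (T : Set (V × V)) : Set (V → ℝ) :=
  convexHull ℝ {x | ∃ p ∈ T, x = stdVec p.2 - stdVec p.1}

/-- A weight function with base vertex `b0`. -/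
structure IsWeight (b0 : V) (f : V → ℝ) : Prop where
  base : f b0 = 1
  lb : ∀ v, v ≠ b0 → -1 ≤ f v
  ub : ∀ v, v ≠ b0 → f v ≤ 0
  total : ∑ v ∈ Finset.univ.erase b0, f v = -1
  indep : LinearIndependent ℚ (fun v : {w : V // w ≠ b0} => f v.1)

/-- The number of lattice points of the `k`-th dilate of the symmetric edge polytope. -/
noncomputable def latticeCount (G : SimpleGraph V) (k : ℕ) : ℕ :=
  Nat.card {x : V → ℤ // (fun v => (x v : ℝ)) ∈ (k : ℝ) • symEdgePolytope G}

/-- `s` is a side of a bipartition of `G`. -/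
def IsBipartition (G : SimpleGraph V) (s : Set V) : Prop :=
  ∀ ⦃u v⦄, G.Adj u v → (u ∈ s ↔ v ∉ s)

/-- A digraph (set of directed edges) is semi-balanced if every cycle of the underlying
undirected graph has the same number of edges oriented in the two cyclic directions. -/
def IsSemiBalanced (D : Set (V × V)) : Prop :=
  ∀ ⦃v : V⦄ (w : (fromDir D).Walk v v), w.IsCycle →
    (w.darts.countP fun d => decide ((d.toProd.1, d.toProd.2) ∈ D)) =
      (w.darts.countP fun d => decide ((d.toProd.2, d.toProd.1) ∈ D))

/-- `D` is an orientation of (all the edges of) `G`. -/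
def IsOrientation (G : SimpleGraph V) (D : Set (V × V)) : Prop :=
  (∀ p ∈ D, G.Adj p.1 p.2) ∧ ∀ ⦃u v⦄, G.Adj u v → ((u, v) ∈ D ↔ (v, u) ∉ D)

/-- The state of the greedy process: the set `H` of included directed edges, the set of
node–edge pairs that have already been current, and the current node–edge pair. -/
structure GreedyState (V : Type*) where
  H : Set (V × V)
  seen : Set (V × V)
  cur : V × V

/-- One step of the (almost-)greedy process in the digraph `D`; `special` is the set of
directed edges that are exceptionally included when first reached at their tail
(`special = ∅` gives the greedy process, `special = {(u,v)}` the u→v-almost greedy one).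
Hidden edges (incident pairs whose edge is absent from `D`) are skipped. -/
noncomputable def greedyStep (D special : Set (V × V)) (ρ : V → V → V)
    (s : GreedyState V) : GreedyState V :=
  let x := s.cur.1
  let y := s.cur.2
  let seen' := s.seen ∪ {s.cur}
  if (y, x) ∈ D then
    -- the current node `x` is the head of the directed edge (y, x)
    if (y, x) ∈ s.seen then ⟨s.H, seen', (x, ρ x y)⟩
    else ⟨s.H ∪ {(y, x)}, seen', (y, ρ y x)⟩
  else if (x, y) ∈ D then
    -- the current node `x` is the tail of the directed edge (x, y)
    if s.cur ∈ special ∧ (y, x) ∉ s.seen then ⟨s.H ∪ {(x, y)}, seen', (y, ρ y x)⟩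
    else if (y, x) ∈ s.seen then ⟨s.H, seen', (y, ρ y x)⟩
    else ⟨s.H, seen', (x, ρ x y)⟩
  else ⟨s.H, seen', (x, ρ x y)⟩

/-- The sequence of states of the (almost-)greedy process started at the basis `(b0, b1)`. -/
noncomputable def greedySeq (D special : Set (V × V)) (ρ : V → V → V) (b0 b1 : V)
    (n : ℕ) : GreedyState V :=
  (greedyStep D special ρ)^[n] ⟨∅, ∅, (b0, b1)⟩

/-- The stopping time of the (almost-)greedy process: the first moment at which a node–edge
pair becomes current for the second time. -/
noncomputable def greedyStopTime (D special : Set (V × V)) (ρ : V → V → V) (b0 b1 : V) : ℕ :=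
  sInf {n | (greedySeq D special ρ b0 b1 n).cur ∈ (greedySeq D special ρ b0 b1 n).seen}

/-- The edge set produced by the (almost-)greedy process. -/
noncomputable def greedyOutput (D special : Set (V × V)) (ρ : V → V → V) (b0 b1 : V) :
    Set (V × V) :=
  (greedySeq D special ρ b0 b1 (greedyStopTime D special ρ b0 b1)).H

/-- The status of the current node–edge pair `p = (x, y)` (node `x`, edge `xy`) with respect
to a facet graph `D` and a tree `T ⊆ D`: `0` if the edge is in the tree oriented y→x,
`1` if it is hidden, `2` if it is oriented x→y in `D` but not in the tree, `3` if it is in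
the tree oriented x→y (and `4` in the remaining case: oriented y→x in `D` but not in `T`). -/
noncomputable def edgeStatus (D T : Set (V × V)) (p : V × V) : ℕ :=
  if (p.2, p.1) ∈ T then 0
  else if (p.1, p.2) ∈ T then 3
  else if (p.1, p.2) ∈ D then 2
  else if (p.2, p.1) ∈ D then 4
  else 1

/-- The quadratic order `<₄` on Jaeger trees (with their facet graphs): the tours, together
with the statuses of the current edges, agree up to step `n`, and at step `n` the status of
the current edge for the first tree is smaller than for the second one. -/
def quadLT (ρ : V → V → V) (b0 b1 : V) (q q' : Set (V × V) × Set (V × V)) : Prop :=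
  ∃ n : ℕ,
    (∀ m < n, tourSeq ρ (und q.2) b0 b1 m = tourSeq ρ (und q'.2) b0 b1 m ∧
      edgeStatus q.1 q.2 (tourSeq ρ (und q.2) b0 b1 m) =
        edgeStatus q'.1 q'.2 (tourSeq ρ (und q'.2) b0 b1 m)) ∧
    tourSeq ρ (und q.2) b0 b1 n = tourSeq ρ (und q'.2) b0 b1 n ∧
    edgeStatus q.1 q.2 (tourSeq ρ (und q.2) b0 b1 n) <
      edgeStatus q'.1 q'.2 (tourSeq ρ (und q'.2) b0 b1 n)

end SEP

namespace SEP

lemma fromDir_adj {V : Type*} [Fintype V] [DecidableEq V] (D : Set (V × V)) (a b : V) :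
    (fromDir D).Adj a b ↔ a ≠ b ∧ ((a, b) ∈ D ∨ (b, a) ∈ D) := by
  simp [fromDir]

/-- Adding an edge to a new vertex `y` keeps the edge set acyclic. -/
lemma acyclic_insert {V : Type*} [Fintype V] [DecidableEq V] (H : Set (V × V)) (e : V × V)
    (x y : V) (he : e = (x, y) ∨ e = (y, x)) (hxy : x ≠ y)
    (hy : ∀ w, ¬ (fromDir H).Adj y w) (hH : (fromDir H).IsAcyclic) :
    (fromDir (H ∪ {e})).IsAcyclic := by
  have hnr : ¬ (fromDir H).Reachable x y :=
    SimpleGraph.not_reachable_of_neighborSet_right_eq_empty hxy (by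
      ext w; simpa using hy w)
  refine (hH.sup_edge_of_not_reachable hnr).anti ?_
  intro a b hab
  rw [fromDir_adj] at hab
  rw [SimpleGraph.sup_adj, fromDir_adj, SimpleGraph.edge_adj]
  rcases he with rfl | rfl <;> simp only [Set.mem_union, Set.mem_singleton_iff, Prod.mk.injEq] at hab <;>
    tauto

lemma dart_snd_ne {V : Type*} {G : SimpleGraph V} {x z : V} (p : G.Walk x z) (hp : p.IsPath)
    (d : G.Dart) (hd : d ∈ p.darts) : d.snd ≠ x := by
  have h := hp.support_nodup
  rw [← SimpleGraph.Walk.cons_map_snd_darts, List.nodup_cons] at h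
  rintro rfl
  exact h.1 (List.mem_map_of_mem hd)

/-- In a semi-balanced graph there is no cycle all of whose edges but one are traversed forward. -/
lemma no_cycle {V : Type*} [Fintype V] [DecidableEq V] (D : Set (V × V))
    (hsb : IsSemiBalanced D) (u v : V) (huv : (u, v) ∈ D) (hsimple : ∀ p ∈ D, (p.2, p.1) ∉ D)
    (x : V) (c : (fromDir D).Walk x x)
    (hc : c.IsCycle) (h : ∀ d ∈ c.darts, (d.fst, d.snd) ∈ D ∨ (d.fst = v ∧ d.snd = u)) : False := by
  have h1 := hsb c hc
  have h3 := hc.three_le_length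
  rw [← SimpleGraph.Walk.length_darts] at h3
  have hsum := List.length_eq_countP_add_countP
    (fun d : (fromDir D).Dart => decide ((d.toProd.1, d.toProd.2) ∈ D)) (l := c.darts)
  have hle : (c.darts.countP fun d => decide ((d.toProd.2, d.toProd.1) ∈ D)) ≤ 1 := by
    have hnd : c.edges.Nodup := hc.isCircuit.isTrail.edges_nodup
    have := List.nodup_iff_count_le_one.1 hnd s(v, u)
    refine le_trans ?_ this
    rw [SimpleGraph.Walk.edges, List.count, List.countP_map]
    refine List.countP_mono_left ?_
    intro d hd hdD
    rcases h d hd with h' | ⟨h', h''⟩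
    · exact absurd (of_decide_eq_true hdD) (hsimple _ h')
    · simp [SimpleGraph.Dart.edge, Sym2.mk, ← h', ← h'']
  have hle2 : (c.darts.countP fun d => decide ¬ (decide ((d.toProd.1, d.toProd.2) ∈ D) = true)) ≤
      (c.darts.countP fun d => decide ((d.toProd.2, d.toProd.1) ∈ D)) := by
    refine List.countP_mono_left ?_
    intro d hd hdD
    rcases h d hd with h' | ⟨h', h''⟩
    · simp at hdD; exact absurd h' hdD
    · have e1 : d.toProd.1 = v := h'
      have e2 : d.toProd.2 = u := h''
      rw [e1, e2]; simpa using huv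
  omega

/-- The invariant of the almost greedy process, witnessed by the stack `p`, a path from the
current vertex to the base vertex. -/
structure GInv {V : Type*} [Fintype V] [DecidableEq V] (D : Set (V × V)) (ρ : V → V → V)
    (b0 u v : V) (H seen : Set (V × V)) (x y : V) (p : (fromDir D).Walk x b0) : Prop where
  path : p.IsPath
  dir : ∀ d ∈ p.darts, (d.fst, d.snd) ∈ D ∨ (d.fst = v ∧ d.snd = u)
  par : ∀ d ∈ p.darts, (d.snd, d.fst) ∈ seen
  start : ∀ d ∈ p.darts, (d.fst, ρ d.fst d.snd) ∈ seen ∪ {(x, y)}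
  ccur : ∀ w, (x, w) ∈ seen → (x, ρ x w) ∈ seen ∪ {(x, y)}
  cpath : ∀ d ∈ p.darts, ∀ w, w ≠ d.fst → (d.snd, w) ∈ seen →
    (d.snd, ρ d.snd w) ∈ seen ∪ {(x, y)}
  vis : ∀ a b, (a, b) ∈ seen → a ∈ p.support ∨ ∀ w, (fromDir D).Adj a w → (a, w) ∈ seen
  tou : ∀ a b, (fromDir H).Adj a b → a ∈ p.support ∨ ∀ w, (fromDir D).Adj a w → (a, w) ∈ seen
  pend : ∀ a b, (b, a) ∈ seen → (a, b) ∈ D → (a, b) ∉ seen →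
    ∃ d ∈ p.darts, d.fst = a ∧ d.snd = b
  acy : (fromDir H).IsAcyclic

lemma GInv.move {V : Type*} [Fintype V] [DecidableEq V] {D : Set (V × V)} {ρ : V → V → V}
    {b0 u v : V} {H seen : Set (V × V)} {x y : V} {p : (fromDir D).Walk x b0}
    (I : GInv D ρ b0 u v H seen x y p)
    (hyx : (y, x) ∈ D → (y, x) ∈ seen) :
    GInv D ρ b0 u v H (seen ∪ {(x, y)}) x (ρ x y) p where
  path := I.path
  dir := I.dir
  par d hd := Or.inl (I.par d hd)
  start d hd := Or.inl (I.start d hd)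
  ccur w hw := by
    rcases hw with hw | hw
    · exact Or.inl (I.ccur w hw)
    · simp only [Set.mem_singleton_iff, Prod.mk.injEq, true_and] at hw
      subst hw; exact Or.inr rfl
  cpath d hd w hw hs := by
    rcases hs with hs | hs
    · exact Or.inl (I.cpath d hd w hw hs)
    · simp only [Set.mem_singleton_iff, Prod.mk.injEq] at hs
      exact absurd hs.1 (dart_snd_ne p I.path d hd)
  vis a b hab := by
    rcases hab with hab | hab
    · exact (I.vis a b hab).imp id fun h w hw => Or.inl (h w hw)
    · simp only [Set.mem_singleton_iff, Prod.mk.injEq] at hab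
      left; rw [hab.1]; exact p.start_mem_support
  tou a b hab := (I.tou a b hab).imp id fun h w hw => Or.inl (h w hw)
  pend a b hba hD hs := by
    rcases hba with hba | hba
    · exact I.pend a b hba hD fun h => hs (Or.inl h)
    · simp only [Set.mem_singleton_iff, Prod.mk.injEq] at hba
      obtain ⟨rfl, rfl⟩ := hba
      exact absurd (Or.inl (hyx hD)) hs
  acy := I.acy

lemma GInv.push {V : Type*} [Fintype V] [DecidableEq V] {D : Set (V × V)}
    (hsb : IsSemiBalanced D) (hsimple : ∀ p ∈ D, (p.2, p.1) ∉ D) {ρ : V → V → V}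
    {b0 u v : V} (huv : (u, v) ∈ D) {H seen : Set (V × V)} {x y : V} {p : (fromDir D).Walk x b0}
    (I : GInv D ρ b0 u v H seen x y p) (e : V × V) (he : e = (x, y) ∨ e = (y, x))
    (hcur : (x, y) ∉ seen) (hrev : (y, x) ∉ seen)
    (hD : (y, x) ∈ D ∨ (y = v ∧ x = u)) :
    ∃ p', GInv D ρ b0 u v (H ∪ {e}) (seen ∪ {(x, y)}) y (ρ y x) p' := by
  have hne : x ≠ y := by
    rintro rfl
    rcases hD with h | ⟨rfl, rfl⟩
    · exact hsimple _ h h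
    · exact hsimple _ huv huv
  have hadj : (fromDir D).Adj y x := by
    rw [fromDir_adj]
    rcases hD with h | ⟨rfl, rfl⟩
    · exact ⟨hne.symm, Or.inl h⟩
    · exact ⟨hne.symm, Or.inr huv⟩
  have hysup : y ∉ p.support := by
    intro hy
    have hsub := p.darts_takeUntil_subset_darts hy
    have hcyc : (SimpleGraph.Walk.cons hadj (p.takeUntil y hy)).IsCycle := by
      rw [SimpleGraph.Walk.cons_isCycle_iff]
      refine ⟨I.path.takeUntil hy, ?_⟩
      intro hmem
      rw [SimpleGraph.Walk.edges, List.mem_map] at hmem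
      obtain ⟨d, hd, hde⟩ := hmem
      have hp := I.par d (hsub hd)
      rw [SimpleGraph.dart_edge_eq_mk'_iff'] at hde
      rcases hde with ⟨h1, h2⟩ | ⟨h1, h2⟩
      · have h1' : d.fst = y := h1
        have h2' : d.snd = x := h2
        rw [h1', h2'] at hp; exact hcur hp
      · have h1' : d.fst = x := h1
        have h2' : d.snd = y := h2
        rw [h1', h2'] at hp; exact hrev hp
    refine no_cycle D hsb u v huv hsimple y _ hcyc ?_
    intro d hd
    rw [SimpleGraph.Walk.darts_cons, List.mem_cons] at hd
    rcases hd with rfl | hd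
    · exact hD
    · exact I.dir d (hsub hd)
  have hfin : ¬ ∀ w, (fromDir D).Adj y w → (y, w) ∈ seen := fun h => hrev (h x hadj)
  have hyseen : ∀ w, (y, w) ∉ seen := fun w h => (I.vis y w h).elim hysup hfin
  have hytou : ∀ w, ¬ (fromDir H).Adj y w := fun w h => (I.tou y w h).elim hysup hfin
  refine ⟨SimpleGraph.Walk.cons hadj p, ?_⟩
  constructor
  · exact I.path.cons hysup
  · intro d hd
    rw [SimpleGraph.Walk.darts_cons, List.mem_cons] at hd
    rcases hd with rfl | hd
    · exact hD
    · exact I.dir d hd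
  · intro d hd
    rw [SimpleGraph.Walk.darts_cons, List.mem_cons] at hd
    rcases hd with rfl | hd
    · exact Or.inr rfl
    · exact Or.inl (I.par d hd)
  · intro d hd
    rw [SimpleGraph.Walk.darts_cons, List.mem_cons] at hd
    rcases hd with rfl | hd
    · exact Or.inr rfl
    · exact Or.inl (I.start d hd)
  · intro w hw
    rcases hw with hw | hw
    · exact absurd hw (hyseen w)
    · simp only [Set.mem_singleton_iff, Prod.mk.injEq] at hw
      exact absurd hw.1.symm hne
  · intro d hd w hw hs
    rw [SimpleGraph.Walk.darts_cons, List.mem_cons] at hd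
    rcases hd with rfl | hd
    · rcases hs with hs | hs
      · exact Or.inl (I.ccur w hs)
      · simp only [Set.mem_singleton_iff, Prod.mk.injEq] at hs
        exact absurd hs.2 hw
    · rcases hs with hs | hs
      · exact Or.inl (I.cpath d hd w hw hs)
      · simp only [Set.mem_singleton_iff, Prod.mk.injEq] at hs
        exact absurd hs.1 (dart_snd_ne p I.path d hd)
  · intro a b hab
    rcases hab with hab | hab
    · refine (I.vis a b hab).imp (fun h => ?_) fun h w hw => Or.inl (h w hw)
      rw [SimpleGraph.Walk.support_cons]; exact List.mem_cons_of_mem _ h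
    · simp only [Set.mem_singleton_iff, Prod.mk.injEq] at hab
      left; rw [hab.1, SimpleGraph.Walk.support_cons]
      exact List.mem_cons_of_mem _ p.start_mem_support
  · intro a b hab
    by_cases hold : (fromDir H).Adj a b
    · refine (I.tou a b hold).imp (fun h => ?_) fun h w hw => Or.inl (h w hw)
      rw [SimpleGraph.Walk.support_cons]; exact List.mem_cons_of_mem _ h
    · have : a = x ∨ a = y := by
        rw [fromDir_adj] at hab hold
        rcases he with rfl | rfl <;>
          simp only [Set.mem_union, Set.mem_singleton_iff, Prod.mk.injEq] at hab <;> tauto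
      left
      rw [SimpleGraph.Walk.support_cons, List.mem_cons]
      rcases this with rfl | rfl
      · exact Or.inr p.start_mem_support
      · exact Or.inl rfl
  · intro a b hba hab hs
    rcases hba with hba | hba
    · obtain ⟨d, hd, h⟩ := I.pend a b hba hab fun h => hs (Or.inl h)
      exact ⟨d, by rw [SimpleGraph.Walk.darts_cons]; exact List.mem_cons_of_mem _ hd, h⟩
    · simp only [Set.mem_singleton_iff, Prod.mk.injEq] at hba
      obtain ⟨rfl, rfl⟩ := hba
      exact ⟨⟨(a, b), hadj⟩, by rw [SimpleGraph.Walk.darts_cons]; exact List.mem_cons_self, rfl, rfl⟩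
  · exact acyclic_insert H e x y he hne hytou I.acy

lemma GInv.pop {V : Type*} [Fintype V] [DecidableEq V] {D : Set (V × V)}
    (hsimple : ∀ p ∈ D, (p.2, p.1) ∉ D) {ρ : V → V → V} (hrib : IsRibbon (fromDir D) ρ)
    {b0 u v : V} {H seen : Set (V × V)} {x y : V} {p : (fromDir D).Walk x b0}
    (I : GInv D ρ b0 u v H seen x y p)
    (hcur : (x, y) ∉ seen) (hrev : (y, x) ∈ seen) (hD : (x, y) ∈ D) :
    ∃ p', GInv D ρ b0 u v H (seen ∪ {(x, y)}) y (ρ y x) p' := by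
  obtain ⟨d, hd, hd1, hd2⟩ := I.pend x y hrev hD hcur
  cases p with
  | nil => simp at hd
  | @cons _ y' _ hadj q =>
    have hpath := I.path
    rw [SimpleGraph.Walk.cons_isPath_iff] at hpath
    obtain ⟨hq, hxq⟩ := hpath
    have hyy : y' = y := by
      rw [SimpleGraph.Walk.darts_cons, List.mem_cons] at hd
      rcases hd with rfl | hd
      · exact hd2
      · exact absurd (hd1 ▸ q.dart_fst_mem_support_of_mem_darts hd) hxq
    subst hyy
    have hne : x ≠ y' := hadj.ne
    have h0 : (⟨(x, y'), hadj⟩ : (fromDir D).Dart) ∈ (SimpleGraph.Walk.cons hadj q).darts := by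
      rw [SimpleGraph.Walk.darts_cons]; exact List.mem_cons_self
    have hin : ∀ d ∈ q.darts, d ∈ (SimpleGraph.Walk.cons hadj q).darts := by
      intro d hd
      rw [SimpleGraph.Walk.darts_cons]; exact List.mem_cons_of_mem _ hd
    have hxfin : ∀ w, (fromDir D).Adj x w → (x, w) ∈ seen ∪ {(x, y')} := by
      intro w hw
      obtain ⟨k, rfl⟩ := hrib.cyc hadj hw
      clear hw
      induction k with
      | zero => exact Or.inr rfl
      | succ k ih =>
        rw [Function.iterate_succ_apply']
        rcases ih with ih | ih
        · exact I.ccur _ ih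
        · simp only [Set.mem_singleton_iff, Prod.mk.injEq, true_and] at ih
          rw [ih]
          exact I.start _ h0
    have hsup : ∀ a, a ∈ (SimpleGraph.Walk.cons hadj q).support →
        a ∈ q.support ∨ ∀ w, (fromDir D).Adj a w → (a, w) ∈ seen ∪ {(x, y')} := by
      intro a ha
      rw [SimpleGraph.Walk.support_cons, List.mem_cons] at ha
      rcases ha with rfl | ha
      · exact Or.inr hxfin
      · exact Or.inl ha
    refine ⟨q, ?_⟩
    constructor
    · exact hq
    · exact fun d hd => I.dir d (hin d hd)
    · exact fun d hd => Or.inl (I.par d (hin d hd))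
    · exact fun d hd => Or.inl (I.start d (hin d hd))
    · intro w hw
      rcases hw with hw | hw
      · by_cases hwx : w = x
        · subst hwx; exact Or.inr rfl
        · exact Or.inl (I.cpath _ h0 w hwx hw)
      · simp only [Set.mem_singleton_iff, Prod.mk.injEq] at hw
        exact absurd hw.1.symm hne
    · intro d hd w hw hs
      rcases hs with hs | hs
      · exact Or.inl (I.cpath d (hin d hd) w hw hs)
      · simp only [Set.mem_singleton_iff, Prod.mk.injEq] at hs
        exact absurd (hs.1 ▸ q.dart_snd_mem_support_of_mem_darts hd) hxq
    · intro a b hab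
      rcases hab with hab | hab
      · rcases I.vis a b hab with h | h
        · exact hsup a h
        · exact Or.inr fun w hw => Or.inl (h w hw)
      · simp only [Set.mem_singleton_iff, Prod.mk.injEq] at hab
        right; rw [hab.1]; exact hxfin
    · intro a b hab
      rcases I.tou a b hab with h | h
      · exact hsup a h
      · exact Or.inr fun w hw => Or.inl (h w hw)
    · intro a b hba hab hs
      rcases hba with hba | hba
      · obtain ⟨d, hd, h1, h2⟩ := I.pend a b hba hab fun h => hs (Or.inl h)
        rw [SimpleGraph.Walk.darts_cons, List.mem_cons] at hd
        rcases hd with rfl | hd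
        · refine absurd (Or.inr ?_) hs
          have h1' : x = a := h1
          have h2' : y' = b := h2
          rw [h1', h2']; rfl
        · exact ⟨d, hd, h1, h2⟩
      · simp only [Set.mem_singleton_iff, Prod.mk.injEq] at hba
        obtain ⟨rfl, rfl⟩ := hba
        exact absurd hab (hsimple _ hD)
    · exact I.acy

lemma ginv_step {V : Type*} [Fintype V] [DecidableEq V] {D : Set (V × V)}
    (hsb : IsSemiBalanced D) (hsimple : ∀ p ∈ D, (p.2, p.1) ∉ D)
    {ρ : V → V → V} (hrib : IsRibbon (fromDir D) ρ)
    {b0 u v : V} (huv : (u, v) ∈ D) (s : GreedyState V) (hcur : s.cur ∉ s.seen)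
    (hI : ∃ p, GInv D ρ b0 u v s.H s.seen s.cur.1 s.cur.2 p) :
    ∃ p, GInv D ρ b0 u v (greedyStep D {(u, v)} ρ s).H (greedyStep D {(u, v)} ρ s).seen
      (greedyStep D {(u, v)} ρ s).cur.1 (greedyStep D {(u, v)} ρ s).cur.2 p := by
  obtain ⟨H, seen, x, y⟩ := s
  obtain ⟨p, I⟩ := hI
  simp only at I hcur
  have key : ∀ t : GreedyState V, greedyStep D {(u, v)} ρ ⟨H, seen, x, y⟩ = t →
      (∃ p, GInv D ρ b0 u v t.H t.seen t.cur.1 t.cur.2 p) →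
      ∃ p, GInv D ρ b0 u v (greedyStep D {(u, v)} ρ ⟨H, seen, x, y⟩).H
        (greedyStep D {(u, v)} ρ ⟨H, seen, x, y⟩).seen
        (greedyStep D {(u, v)} ρ ⟨H, seen, x, y⟩).cur.1
        (greedyStep D {(u, v)} ρ ⟨H, seen, x, y⟩).cur.2 p := by
    rintro t rfl h
    exact h
  by_cases h1 : (y, x) ∈ D
  · by_cases h2 : (y, x) ∈ seen
    · exact key ⟨H, seen ∪ {(x, y)}, (x, ρ x y)⟩ (by simp only [greedyStep, h1, h2, if_true])
        ⟨p, I.move fun _ => h2⟩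
    · exact key ⟨H ∪ {(y, x)}, seen ∪ {(x, y)}, (y, ρ y x)⟩
        (by simp only [greedyStep, h1, h2, if_true, if_false])
        (I.push hsb hsimple huv _ (Or.inr rfl) hcur h2 (Or.inl h1))
  · by_cases h2 : (x, y) ∈ D
    · by_cases h3 : (x, y) ∈ ({(u, v)} : Set (V × V)) ∧ (y, x) ∉ seen
      · have h4 := h3.1
        simp only [Set.mem_singleton_iff, Prod.mk.injEq] at h4
        exact key ⟨H ∪ {(x, y)}, seen ∪ {(x, y)}, (y, ρ y x)⟩
          (by simp only [greedyStep]; rw [if_neg h1, if_pos h2, if_pos h3])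
          (I.push hsb hsimple huv _ (Or.inl rfl) hcur h3.2 (Or.inr ⟨h4.2, h4.1⟩))
      · by_cases h5 : (y, x) ∈ seen
        · exact key ⟨H, seen ∪ {(x, y)}, (y, ρ y x)⟩
            (by simp only [greedyStep]; rw [if_neg h1, if_pos h2, if_neg h3, if_pos h5])
            (I.pop hsimple hrib hcur h5 h2)
        · exact key ⟨H, seen ∪ {(x, y)}, (x, ρ x y)⟩
            (by simp only [greedyStep]; rw [if_neg h1, if_pos h2, if_neg h3, if_neg h5])
            ⟨p, I.move fun h => absurd h h1⟩
    · exact key ⟨H, seen ∪ {(x, y)}, (x, ρ x y)⟩ (by simp only [greedyStep, h1, h2, if_false])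
        ⟨p, I.move fun h => absurd h h1⟩

lemma ginv_seq {V : Type*} [Fintype V] [DecidableEq V] {D : Set (V × V)}
    (hsb : IsSemiBalanced D) (hsimple : ∀ p ∈ D, (p.2, p.1) ∉ D)
    {ρ : V → V → V} (hrib : IsRibbon (fromDir D) ρ)
    {b0 b1 u v : V} (huv : (u, v) ∈ D) (n : ℕ)
    (hn : ∀ m < n, (greedySeq D {(u, v)} ρ b0 b1 m).cur ∉ (greedySeq D {(u, v)} ρ b0 b1 m).seen) :
    ∃ p, GInv D ρ b0 u v (greedySeq D {(u, v)} ρ b0 b1 n).H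
      (greedySeq D {(u, v)} ρ b0 b1 n).seen (greedySeq D {(u, v)} ρ b0 b1 n).cur.1
      (greedySeq D {(u, v)} ρ b0 b1 n).cur.2 p := by
  induction n with
  | zero =>
    have hH : fromDir (∅ : Set (V × V)) = ⊥ := by
      ext a b; simp [fromDir_adj]
    refine ⟨(SimpleGraph.Walk.nil : (fromDir D).Walk b0 b0), ?_⟩
    constructor <;> simp [greedySeq, hH]
  | succ n ih =>
    have := ginv_step hsb hsimple hrib huv (greedySeq D {(u, v)} ρ b0 b1 n)
      (hn n (Nat.lt_succ_self n)) (ih fun m hm => hn m (hm.trans (Nat.lt_succ_self n)))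
    have e : greedySeq D {(u, v)} ρ b0 b1 (n + 1) =
        greedyStep D {(u, v)} ρ (greedySeq D {(u, v)} ρ b0 b1 n) := by
      rw [greedySeq, Function.iterate_succ_apply']; rfl
    rw [e]; exact this

/-- The u→v-almost greedy process in a finite simple semi-balanced ribbon digraph produces
an acyclic edge set, i.e. a (not necessarily spanning) tree. -/
theorem almost_greedy_tree_is_a_tree
    {V : Type*} [Fintype V] [DecidableEq V]
    (D : Set (V × V)) (hsb : IsSemiBalanced D)
    (hsimple : ∀ p ∈ D, (p.2, p.1) ∉ D)
    (ρ : V → V → V) (hrib : IsRibbon (fromDir D) ρ)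
    (b0 b1 : V) (hb : (fromDir D).Adj b0 b1)
    (u v : V) (huv : (u, v) ∈ D) :
    (fromDir (greedyOutput D {(u, v)} ρ b0 b1)).IsAcyclic := by
  obtain ⟨p, I⟩ := ginv_seq (b0 := b0) (b1 := b1) hsb hsimple hrib huv
    (greedyStopTime D {(u, v)} ρ b0 b1) (fun m hm => Nat.notMem_of_lt_sInf hm)
  exact I.acy

end SEP
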